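/- arXiv:2203.07283 — 8 statements merged into one kernel-verified Lean document; each statement's English description precedes it below -/
import Mathlib

section
/- Let G be a CGS with initial state s0, A ⊆ Ξ a set of agents, and P an arbitrary property of pairs of infinite state sequences. If there exists a set F_A of 2-strategies for the agents in A such that every outcome (p, p') ∈ out(G, (s0, s0), ∅, F_A) (first copy unconstrained, agents in A constrained by F_A in the second copy) satisfies P(p, p'), then for every path p of G from s0 there exists a set F'_A of ordinary strategies for the agents in A such that every p' ∈ out(G, s0, F'_A) satisfies P(p, p'). -/
/-- A concurrent game structure over states `S`, agents `Agent`, moves `M`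
and atomic propositions `AP`. -/
structure CGS (S Agent M AP : Type) where
  s0 : S
  δ : S → (Agent → M) → S
  Lab : S → Set AP

/-- The history `p(0) ⋯ p(i)`. -/
def hist {S : Type} (p : ℕ → S) (i : ℕ) : List S :=
  (List.range (i + 1)).map p

/-- `p` is a path from `s` in the game structure with transition function `δ`. -/
def IsPath {S Agent M : Type} (δ : S → (Agent → M) → S) (s : S) (p : ℕ → S) : Prop :=
  p 0 = s ∧ ∀ i, ∃ σ : Agent → M, δ (p i) σ = p (i + 1)

/-- `p ∈ out(G, s, F)`: outcomes from `s` when the agents in `A` follow the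
ordinary strategies `F`. -/
def InOut {S Agent M : Type} (δ : S → (Agent → M) → S) (A : Set Agent)
    (F : Agent → List S → M) (s : S) (p : ℕ → S) : Prop :=
  p 0 = s ∧ ∀ i, ∃ σ : Agent → M, δ (p i) σ = p (i + 1) ∧
    ∀ ξ ∈ A, σ ξ = F ξ (hist p i)

/-- An outcome of the 2-copy parallel game: the first copy is unconstrained,
the agents in `A` follow the 2-strategies `F` in the second copy. -/
def InOut2 {S Agent M : Type} (δ : S → (Agent → M) → S) (A : Set Agent)
    (F : Agent → List (S × S) → M) (s₁ s₂ : S) (u : ℕ → S × S) : Prop :=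
  u 0 = (s₁, s₂) ∧ ∀ i, ∃ σ₁ σ₂ : Agent → M,
    u (i + 1) = (δ (u i).1 σ₁, δ (u i).2 σ₂) ∧
    ∀ ξ ∈ A, σ₂ ξ = F ξ (hist u i)

/-- The history of a pair of sequences is the zip of their histories. -/
theorem hist_prodMk {S T : Type} (p : ℕ → S) (q : ℕ → T) (i : ℕ) :
    hist (fun t => (p t, q t)) i = ((List.range (hist q i).length).map p).zip (hist q i) := by
  simp [hist, List.zip_map']

/-- If the agents in `A` have 2-strategies winning in the parallel game
(first copy unconstrained), then for every path `p` of `G` they have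
ordinary strategies whose outcomes `p'` all satisfy `P p p'`. -/
theorem parallel_strategy_implies_sequential {S Agent M AP : Type}
    [Fintype S] [Fintype Agent] [Nonempty Agent] [Fintype M] [Nonempty M] [Fintype AP]
    (G : CGS S Agent M AP) (A : Set Agent)
    (P : (ℕ → S) → (ℕ → S) → Prop)
    (h : ∃ F : Agent → List (S × S) → M,
      ∀ u : ℕ → S × S, InOut2 G.δ A F G.s0 G.s0 u →
        P (fun t => (u t).1) (fun t => (u t).2)) :
    ∀ p : ℕ → S, IsPath G.δ G.s0 p →
      ∃ F' : Agent → List S → M,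
        ∀ p' : ℕ → S, InOut G.δ A F' G.s0 p' → P p p' := by
  obtain ⟨F, hF⟩ := h
  rintro p ⟨hp0, hp⟩
  refine ⟨fun ξ l => F ξ (((List.range l.length).map p).zip l), ?_⟩
  rintro p' ⟨hp'0, hp'⟩
  refine hF (fun t => (p t, p' t)) ⟨by simp [hp0, hp'0], fun i => ?_⟩
  obtain ⟨σ₁, h₁⟩ := hp i
  obtain ⟨σ₂, h₂, hA⟩ := hp' i
  refine ⟨σ₁, σ₂, by simp [h₁, h₂], fun ξ hξ => ?_⟩
  rw [hA ξ hξ, hist_prodMk]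
end

section
/- Let G be a CGS with initial state s0, A ⊆ Ξ a set of agents, k ≥ 1, and P an arbitrary property of (k+1)-tuples of infinite state sequences. If there exists a set F_A of (k+1)-strategies for the agents in A such that every outcome (p_1, …, p_k, p') ∈ out(G, (s0, …, s0), ∅, …, ∅, F_A) (the first k copies unconstrained, agents in A constrained by F_A in the last copy) satisfies P(p_1, …, p_k, p'), then for all paths p_1, …, p_k of G from s0 there exists a set F'_A of ordinary strategies for the agents in A such that every p' ∈ out(G, s0, F'_A) satisfies P(p_1, …, p_k, p'). -/
/-- An outcome of the (k+1)-copy parallel game: the first `k` copies are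
unconstrained, the agents in `A` follow the (k+1)-strategies `F` in the last
copy.  The joint state of the (k+1) copies is an element of `(Fin k → S) × S`. -/
def InOutPar {S Agent M : Type} {k : ℕ} (δ : S → (Agent → M) → S) (A : Set Agent)
    (F : Agent → List ((Fin k → S) × S) → M) (s : S) (u : ℕ → (Fin k → S) × S) : Prop :=
  u 0 = (fun _ => s, s) ∧ ∀ i, ∃ (σ : Fin k → Agent → M) (σ' : Agent → M),
    u (i + 1) = (fun j => δ ((u i).1 j) (σ j), δ (u i).2 σ') ∧
    ∀ ξ ∈ A, σ' ξ = F ξ (hist u i)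

/-- The history of a product sequence is obtained from the history of its second component by
attaching to each position the value of the first component there. -/
theorem map_zipIdx_hist {S T : Type} (q : ℕ → T) (p : ℕ → S) (i : ℕ) :
    (hist p i).zipIdx.map (fun x => (q x.2, x.1)) = hist (fun t => (q t, p t)) i := by
  apply List.ext_getElem <;> simp [hist]

/-- If the agents in `A` have (k+1)-strategies winning in the parallel game
(first `k` copies unconstrained), then for all paths `p_1, …, p_k` of `G` they
have ordinary strategies whose outcomes `p'` all satisfy `P (p_1, …, p_k) p'`. -/
theorem parallel_strategy_implies_sequential_k {S Agent M AP : Type}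
    [Fintype S] [Fintype Agent] [Nonempty Agent] [Fintype M] [Nonempty M] [Fintype AP]
    (G : CGS S Agent M AP) (A : Set Agent) (k : ℕ) (hk : 1 ≤ k)
    (P : (Fin k → ℕ → S) → (ℕ → S) → Prop)
    (h : ∃ F : Agent → List ((Fin k → S) × S) → M,
      ∀ u : ℕ → (Fin k → S) × S, InOutPar G.δ A F G.s0 u →
        P (fun j t => (u t).1 j) (fun t => (u t).2)) :
    ∀ ps : Fin k → ℕ → S, (∀ j, IsPath G.δ G.s0 (ps j)) →
      ∃ F' : Agent → List S → M,
        ∀ p' : ℕ → S, InOut G.δ A F' G.s0 p' → P ps p' := by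
  obtain ⟨F, hF⟩ := h
  intro ps hps
  refine ⟨fun ξ l => F ξ (l.zipIdx.map fun x => (fun j => ps j x.2, x.1)), fun p' hp' => ?_⟩
  refine hF (fun t => (fun j => ps j t, p' t)) ⟨?_, fun i => ?_⟩
  · exact Prod.ext (funext fun j => (hps j).1) hp'.1
  · choose σ hσ using fun j => (hps j).2 i
    obtain ⟨σ', hσ', hA⟩ := hp'.2 i
    refine ⟨σ, σ', Prod.ext (funext fun j => (hσ j).symm) hσ'.symm, fun ξ hξ => ?_⟩
    exact (hA ξ hξ).trans (congrArg (F ξ) (map_zipIdx_hist (fun t j => ps j t) p' i))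
end

section
/- Let G be a CGS over AP = H ∪ L ∪ O (pairwise disjoint) with state set S, initial state s0 and labeling Lab, let n ≥ 0, and let G' = shift(G, n) (with shift(G,0) = G) with state set S', initial state s'_init, transition function δ' and labeling Lab'. Suppose there exists a function g : (S × S × S')⁺ → (Ξ → M) such that for all paths p, p' of G from s0, the sequence p'' defined by p''(0) = s'_init and p''(t+1) = δ'(p''(t), g((p(0), p'(0), p''(0)) ⋯ (p(t), p'(t), p''(t)))) satisfies, for all t: Lab(p(t)) ∩ H = Lab'(p''(t+n)) ∩ H and Lab(p'(t)) ∩ (L ∪ O) = Lab'(p''(t+n)) ∩ (L ∪ O). Then G satisfies GNI, i.e., for all paths p, p' of G from s0 there exists a path q of G from s0 with Lab(p(t)) ∩ H = Lab(q(t)) ∩ H and Lab(p'(t)) ∩ (L ∪ O) = Lab(q(t)) ∩ (L ∪ O) for all t. -/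
/-- The state space of `shift(G, n)`: the original states `S` plus `n` fresh
initial states. -/
abbrev ShiftState (S : Type) (n : ℕ) : Type := S ⊕ Fin n

/-- The initial state of `shift(G, n)` (for `n = 0` it is the original
initial state `s0`). -/
def shiftInit {S : Type} (s0 : S) (n : ℕ) : ShiftState S n :=
  if h : 0 < n then Sum.inr ⟨0, h⟩ else Sum.inl s0

/-- The transition function of `shift(G, n)`: the fresh states form a chain of
length `n` leading (on every move vector) to the original initial state `s0`,
after which `shift(G, n)` behaves as `G`. -/
def shiftδ {S Agent M : Type} (s0 : S) (δ : S → (Agent → M) → S) (n : ℕ) :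
    ShiftState S n → (Agent → M) → ShiftState S n
  | Sum.inl s, σ => Sum.inl (δ s σ)
  | Sum.inr i, _ => if h : (i : ℕ) + 1 < n then Sum.inr ⟨(i : ℕ) + 1, h⟩ else Sum.inl s0

/-- The labeling of `shift(G, n)`: fresh states are labeled by `∅`. -/
def shiftLab {S AP : Type} {n : ℕ} (Lab : S → Set AP) : ShiftState S n → Set AP
  | Sum.inl s => Lab s
  | Sum.inr _ => ∅

/-- A sequence whose next value is determined by its current value and the list of
all (tagged) values so far exists. -/
theorem exists_seq_of_history {X Y : Type*} (x₀ : X) (tag : ℕ → X → Y)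
    (next : X → List Y → X) :
    ∃ x : ℕ → X, x 0 = x₀ ∧
      ∀ t, x (t + 1) = next (x t) ((List.range (t + 1)).map fun i => tag i (x i)) := by
  let st : ℕ → List Y × X := fun t => Nat.rec ([], x₀)
    (fun t r => (r.1 ++ [tag t r.2], next r.2 (r.1 ++ [tag t r.2]))) t
  have hist : ∀ t, (st t).1 = (List.range t).map fun i => tag i (st i).2 := by
    intro t
    induction t with
    | zero => rfl
    | succ t ih =>
      rw [List.range_succ, List.map_append, ← ih]
      rfl
  refine ⟨fun t => (st t).2, rfl, fun t => ?_⟩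
  rw [← hist (t + 1)]

/-- Every play of `shift(G, n)` from its initial state is, after `n` steps, a path of `G`. -/
theorem exists_isPath_of_shift {S Agent M : Type} {s0 : S} {δ : S → (Agent → M) → S} {n : ℕ}
    {u : ℕ → ShiftState S n} (hu0 : u 0 = shiftInit s0 n)
    (hu : ∀ t, ∃ σ : Agent → M, u (t + 1) = shiftδ s0 δ n (u t) σ) :
    ∃ q : ℕ → S, IsPath δ s0 q ∧ ∀ t, u (t + n) = Sum.inl (q t) := by
  have fresh : ∀ t, t ≤ n → u t = if h : t < n then Sum.inr ⟨t, h⟩ else Sum.inl s0 := by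
    intro t
    induction t with
    | zero => exact fun _ => hu0
    | succ t ih =>
      intro ht
      obtain ⟨σ, hσ⟩ := hu t
      rw [hσ, ih (by omega), dif_pos (by omega)]
      rfl
  have hn : u n = Sum.inl s0 := by simpa using fresh n le_rfl
  have original : ∀ t, ∃ s, u (t + n) = Sum.inl s := by
    intro t
    induction t with
    | zero => exact ⟨s0, by simpa using hn⟩
    | succ t ih =>
      obtain ⟨s, hs⟩ := ih
      obtain ⟨σ, hσ⟩ := hu (t + n)
      exact ⟨δ s σ, by rw [Nat.add_right_comm, hσ, hs]; rfl⟩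
  choose q hq using original
  refine ⟨q, ⟨?_, fun t => ?_⟩, hq⟩
  · have h0 := hq 0
    rw [Nat.zero_add, hn] at h0
    exact (Sum.inl.inj h0).symm
  · obtain ⟨σ, hσ⟩ := hu (t + n)
    rw [← Nat.add_right_comm, hq, hq] at hσ
    exact ⟨σ, (Sum.inl.inj hσ).symm⟩

/-- If there is a strategy `g` constructing, in `shift(G, n)`, from any two
paths `p, p'` of `G`, a shifted witness path `p''` matching the `H`-labels of
`p` and the `(L ∪ O)`-labels of `p'`, then `G` satisfies GNI. -/
theorem shifted_witness_strategy_implies_GNI {S Agent M AP : Type}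
    [Fintype S] [Fintype Agent] [Nonempty Agent] [Fintype M] [Nonempty M] [Fintype AP]
    (s0 : S) (δ : S → (Agent → M) → S) (Lab : S → Set AP)
    (Hs Ls Os : Set AP)
    (disjHL : Disjoint Hs Ls) (disjHO : Disjoint Hs Os) (disjLO : Disjoint Ls Os)
    (cover : Hs ∪ Ls ∪ Os = Set.univ)
    (n : ℕ)
    (h : ∃ g : List (S × S × ShiftState S n) → (Agent → M),
      ∀ p p' : ℕ → S, IsPath δ s0 p → IsPath δ s0 p' →
        ∀ p'' : ℕ → ShiftState S n,
          (p'' 0 = shiftInit s0 n ∧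
           ∀ t, p'' (t + 1) = shiftδ s0 δ n (p'' t)
              (g ((List.range (t + 1)).map (fun i => (p i, p' i, p'' i))))) →
          ∀ t, Lab (p t) ∩ Hs = shiftLab Lab (p'' (t + n)) ∩ Hs ∧
               Lab (p' t) ∩ (Ls ∪ Os) = shiftLab Lab (p'' (t + n)) ∩ (Ls ∪ Os)) :
    ∀ p p' : ℕ → S, IsPath δ s0 p → IsPath δ s0 p' →
      ∃ q : ℕ → S, IsPath δ s0 q ∧
        (∀ t, Lab (p t) ∩ Hs = Lab (q t) ∩ Hs) ∧
        (∀ t, Lab (p' t) ∩ (Ls ∪ Os) = Lab (q t) ∩ (Ls ∪ Os)) := by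
  intro p p' hp hp'
  obtain ⟨g, hg⟩ := h
  obtain ⟨u, hu0, hu⟩ := exists_seq_of_history (shiftInit s0 n)
    (fun i x => (p i, p' i, x)) (fun x l => shiftδ s0 δ n x (g l))
  obtain ⟨q, hq, huq⟩ := exists_isPath_of_shift hu0 fun t => ⟨_, hu t⟩
  have key := hg p p' hp hp' u ⟨hu0, hu⟩
  simp only [huq] at key
  exact ⟨q, hq, fun t => (key t).1, fun t => (key t).2⟩
end

section
/- Let T = (S, s0, δ, Lab) be a transition system in which every state has a successor, let n ≥ 1, and let Φ be an arbitrary property of n-tuples of infinite state sequences. If there exists an n-scheduler g such that every play (u, prop) of the scheduled game on T is fair for every copy and satisfies Φ(u_1, …, u_n), where u_j(t) denotes the j-th component of u(t), then for all paths p_1, …, p_n of T from s0 there exist p'_1, …, p'_n with p_j ⊴ p'_j for each j and Φ(p'_1, …, p'_n). -/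
/-- `p` is a path of the transition system `(S, s0, δ, Lab)` from `s`. -/
def TSPath {S : Type} (δ : S → S → Prop) (s : S) (p : ℕ → S) : Prop :=
  p 0 = s ∧ ∀ i, δ (p i) (p (i + 1))

/-- `p' ` is a stuttering of `p` (`p ⊴ p'`). -/
def Stutters {S : Type} (p p' : ℕ → S) : Prop :=
  ∃ g : ℕ → ℕ, Monotone g ∧ Function.Surjective g ∧ g 0 = 0 ∧ ∀ t, p' t = p (g t)

/-- The joint history `u(0) ⋯ u(i)` of the `n` copies. -/
def histn {S : Type} {n : ℕ} (u : ℕ → Fin n → S) (i : ℕ) : List (Fin n → S) :=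
  (List.range (i + 1)).map u

/-- A play `(u, prop)` of the scheduled game on `T` with `n`-scheduler `g`:
each copy proposes a `δ`-successor and exactly the copies selected by the
scheduler progress. -/
def IsPlay {S : Type} {n : ℕ} (s0 : S) (δ : S → S → Prop)
    (g : List (Fin n → S) → (Fin n → S) → Finset (Fin n))
    (u prop : ℕ → Fin n → S) : Prop :=
  u 0 = (fun _ => s0) ∧
  ∀ i, (∀ j, δ (u i j) (prop i j)) ∧
    ∀ j, u (i + 1) j = if j ∈ g (histn u i) (prop i) then prop i j else u i j

/-- The play `(u, prop)` is fair for copy `j`: copy `j` is scheduled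
infinitely often. -/
def FairFor {S : Type} {n : ℕ}
    (g : List (Fin n → S) → (Fin n → S) → Finset (Fin n))
    (u prop : ℕ → Fin n → S) (j : Fin n) : Prop :=
  ∀ N, ∃ i ≥ N, j ∈ g (histn u i) (prop i)

/-- The joint history and the positions of the `n` copies along the paths `ps`
when every copy always proposes the next state of its path. -/
def followPaths {S : Type} {n : ℕ}
    (g : List (Fin n → S) → (Fin n → S) → Finset (Fin n)) (ps : Fin n → ℕ → S) :
    ℕ → List (Fin n → S) × (Fin n → ℕ)
  | 0 => ([fun j => ps j 0], fun _ => 0)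
  | i + 1 =>
    let q := followPaths g ps i
    let k : Fin n → ℕ := fun j =>
      if j ∈ g q.1 (fun j => ps j (q.2 j + 1)) then q.2 j + 1 else q.2 j
    (q.1 ++ [fun j => ps j (k j)], k)

theorem followPaths_fst {S : Type} {n : ℕ}
    (g : List (Fin n → S) → (Fin n → S) → Finset (Fin n)) (ps : Fin n → ℕ → S) (i : ℕ) :
    (followPaths g ps i).1 = histn (fun t j => ps j ((followPaths g ps t).2 j)) i := by
  induction i with
  | zero => simp [histn, followPaths]
  | succ i ih =>
    rw [histn, List.range_succ, List.map_append, ← histn, ← ih]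
    rfl

theorem followPaths_snd_succ {S : Type} {n : ℕ}
    (g : List (Fin n → S) → (Fin n → S) → Finset (Fin n)) (ps : Fin n → ℕ → S)
    (i : ℕ) (j : Fin n) :
    (followPaths g ps (i + 1)).2 j =
      if j ∈ g (histn (fun t j => ps j ((followPaths g ps t).2 j)) i)
          (fun j => ps j ((followPaths g ps i).2 j + 1))
      then (followPaths g ps i).2 j + 1 else (followPaths g ps i).2 j := by
  rw [← followPaths_fst]
  rfl

/-- A counter that starts at `0`, moves by at most one and moves infinitely often
takes every value. -/
theorem surjective_of_frequently_succ {k : ℕ → ℕ} (h0 : k 0 = 0)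
    (hmono : Monotone k) (hle : ∀ i, k (i + 1) ≤ k i + 1)
    (hinf : ∀ N, ∃ i ≥ N, k (i + 1) = k i + 1) : Function.Surjective k := by
  intro m
  induction m with
  | zero => exact ⟨0, h0⟩
  | succ m ih =>
    obtain ⟨t, ht⟩ := ih
    obtain ⟨i, hi, hik⟩ := hinf t
    have hex : ∃ r, m + 1 ≤ k r := ⟨i + 1, by have := hmono hi; omega⟩
    classical
    obtain ⟨r, hr, hmin⟩ : ∃ r, m + 1 ≤ k r ∧ ∀ r' < r, ¬ m + 1 ≤ k r' :=
      ⟨Nat.find hex, Nat.find_spec hex, fun _ => Nat.find_min hex⟩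
    cases r with
    | zero => omega
    | succ r =>
      have := hmin r (by omega)
      have := hle r
      exact ⟨r + 1, by omega⟩

/-- If some `n`-scheduler makes every play fair for all copies and satisfy
`Φ`, then any `n` paths of `T` admit stutterings jointly satisfying `Φ`. -/
theorem scheduler_implies_stutterings {S AP : Type} [Fintype S]
    (s0 : S) (δ : S → S → Prop) (hserial : ∀ s, ∃ s', δ s s')
    (Lab : S → Set AP) (n : ℕ) (hn : 1 ≤ n)
    (Φ : (Fin n → ℕ → S) → Prop)
    (h : ∃ g : List (Fin n → S) → (Fin n → S) → Finset (Fin n),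
      ∀ u prop : ℕ → Fin n → S, IsPlay s0 δ g u prop →
        (∀ j, FairFor g u prop j) ∧ Φ (fun j t => u t j)) :
    ∀ ps : Fin n → ℕ → S, (∀ j, TSPath δ s0 (ps j)) →
      ∃ ps' : Fin n → ℕ → S, (∀ j, Stutters (ps j) (ps' j)) ∧ Φ ps' := by
  intro ps hps
  obtain ⟨g, hg⟩ := h
  have hstep := followPaths_snd_succ g ps
  obtain ⟨hfair, hΦ⟩ := hg (fun t j => ps j ((followPaths g ps t).2 j))
    (fun t j => ps j ((followPaths g ps t).2 j + 1))
    ⟨funext fun j => (hps j).1, fun i => ⟨fun j => (hps j).2 _, fun j =>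
      (congrArg (ps j) (hstep i j)).trans (apply_ite (ps j) _ _ _)⟩⟩
  refine ⟨_, fun j => ?_, hΦ⟩
  have hmono : Monotone fun t => (followPaths g ps t).2 j := by
    refine monotone_nat_of_le_succ fun i => ?_
    rw [hstep]
    split_ifs <;> omega
  refine ⟨fun t => (followPaths g ps t).2 j, hmono, ?_, rfl, fun _ => rfl⟩
  refine surjective_of_frequently_succ rfl hmono (fun i => ?_) fun N => ?_
  · rw [hstep]
    split_ifs <;> omega
  · obtain ⟨i, hi, hij⟩ := hfair j N
    exact ⟨i, hi, by rw [hstep, if_pos hij]⟩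
end

section
/- Let T = (S, s0, δ, Lab) be a transition system in which every state has a successor, let P ⊆ AP, let Φ_state be an arbitrary property of pairs of states, and let Φ_1, Φ_2 be stutter-invariant properties of infinite state sequences (i.e., Φ_i(p) ↔ Φ_i(p') whenever p ⊴ p'). Define Φ(w_1, w_2) := Φ_state(w_1(0), w_2(0)) ∧ Φ_1(w_1) ∧ Φ_2(w_2) ∧ (∀t, Lab(w_1(t)) ∩ P = Lab(w_2(t)) ∩ P). Then the following are equivalent: (1) there exists a 2-scheduler g such that every play (u, prop) of the scheduled game on T is fair for both copies and satisfies Φ(u_1, u_2); (2) for all paths p_1, p_2 of T from s0 there exist p'_1, p'_2 with p_1 ⊴ p'_1, p_2 ⊴ p'_2 and Φ(p'_1, p'_2). -/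
/-- The semantic form of an admissible formula: a state property on the initial
states, stutter-invariant single-path properties, and a phase property over `P`. -/
def AdmissibleProp {S AP : Type} (Lab : S → Set AP) (P : Set AP)
    (Φstate : S → S → Prop) (Φ1 Φ2 : (ℕ → S) → Prop) (w1 w2 : ℕ → S) : Prop :=
  Φstate (w1 0) (w2 0) ∧ Φ1 w1 ∧ Φ2 w2 ∧ ∀ t, Lab (w1 t) ∩ P = Lab (w2 t) ∩ P

open Classical in
/-- The number of value changes of the sequence `x` before time `t`. -/
noncomputable def changeCount {C : Type} (x : ℕ → C) (t : ℕ) : ℕ :=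
  Nat.count (fun i => x i ≠ x (i + 1)) t

/-- The values of `x`, each tagged with the number of value changes preceding it. -/
def phaseTrace {C : Type} (x : ℕ → C) : Set (ℕ × C) :=
  Set.range fun t => (changeCount x t, x t)

lemma changeCount_succ_of_eq {C : Type} {x : ℕ → C} {t : ℕ} (h : x t = x (t + 1)) :
    changeCount x (t + 1) = changeCount x t := by
  simp [changeCount, Nat.count_succ, h]

lemma changeCount_succ_of_ne {C : Type} {x : ℕ → C} {t : ℕ} (h : x t ≠ x (t + 1)) :
    changeCount x (t + 1) = changeCount x t + 1 := by
  simp [changeCount, Nat.count_succ, h]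

lemma changeCount_mono {C : Type} (x : ℕ → C) : Monotone (changeCount x) := by
  classical exact Nat.count_monotone _

lemma changeCount_congr {C : Type} {x y : ℕ → C} {t : ℕ} (h : ∀ s ≤ t, x s = y s) :
    changeCount x t = changeCount y t := by
  induction t with
  | zero => simp [changeCount]
  | succ t ih =>
    have ih := ih fun s hs => h s (by omega)
    by_cases hx : x t = x (t + 1)
    · rw [changeCount_succ_of_eq hx, changeCount_succ_of_eq, ih]
      rw [← h t (by omega), ← h (t + 1) le_rfl, hx]
    · rw [changeCount_succ_of_ne hx, changeCount_succ_of_ne, ih]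
      rwa [← h t (by omega), ← h (t + 1) le_rfl]

lemma eq_of_changeCount_eq {C : Type} {x : ℕ → C} {s t : ℕ}
    (h : changeCount x s = changeCount x t) : x s = x t := by
  have key : ∀ d s, changeCount x s = changeCount x (s + d) → x s = x (s + d) := by
    intro d
    induction d with
    | zero => intro s _; rfl
    | succ d ih =>
      intro s h
      have hm := changeCount_mono x (show s ≤ s + d by omega)
      by_cases hx : x (s + d) = x (s + d + 1)
      · rw [← add_assoc, changeCount_succ_of_eq hx] at h
        rw [ih s h, hx, add_assoc]
      · rw [← add_assoc, changeCount_succ_of_ne hx] at h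
        omega
  rcases le_total s t with hst | hst
  · obtain ⟨d, rfl⟩ := Nat.exists_eq_add_of_le hst
    exact key d s h
  · obtain ⟨d, rfl⟩ := Nat.exists_eq_add_of_le hst
    exact (key d t h.symm).symm

lemma changeCount_le_of_eventually_const {C : Type} {x : ℕ → C} {N : ℕ}
    (h : ∀ i ≥ N, x i = x (i + 1)) (t : ℕ) : changeCount x t ≤ changeCount x N := by
  induction t with
  | zero => simp [changeCount]
  | succ t ih =>
    rcases le_or_gt N t with ht | ht
    · rwa [changeCount_succ_of_eq (h t ht)]
    · exact changeCount_mono x (by omega)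

lemma eq_of_phaseTrace_eq {C : Type} {x y : ℕ → C} {s t : ℕ} (h : phaseTrace x = phaseTrace y)
    (hc : changeCount x s = changeCount y t) : x s = y t := by
  have hm : (changeCount x s, x s) ∈ phaseTrace y := h ▸ ⟨s, rfl⟩
  obtain ⟨r, hr⟩ := hm
  simp only [Prod.mk.injEq] at hr
  rw [← hr.2]
  exact eq_of_changeCount_eq (hr.1.trans hc)

lemma Stutters.comp {S C : Type} {p p' : ℕ → S} (h : Stutters p p') (c : S → C) :
    Stutters (c ∘ p) (c ∘ p') := by
  obtain ⟨g, h1, h2, h3, h4⟩ := h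
  exact ⟨g, h1, h2, h3, fun t => congrArg c (h4 t)⟩

lemma Stutters.phaseTrace_eq {C : Type} {x y : ℕ → C} (h : Stutters x y) :
    phaseTrace y = phaseTrace x := by
  obtain ⟨g, hmono, hsurj, h0, hg⟩ := h
  have hstep : ∀ t, g (t + 1) = g t ∨ g (t + 1) = g t + 1 := by
    intro t
    obtain ⟨s, hs⟩ := hsurj (g t + 1)
    have hle := hmono (Nat.le_succ t)
    rcases le_or_gt s t with hst | hst
    · have := hmono hst
      omega
    · have := hmono (show t + 1 ≤ s from hst)
      simp only [Nat.succ_eq_add_one] at hle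
      omega
  have hcount : ∀ t, changeCount y t = changeCount x (g t) := by
    intro t
    induction t with
    | zero => simp [changeCount, h0]
    | succ t ih =>
      rcases hstep t with hs | hs
      · rw [changeCount_succ_of_eq (by rw [hg, hg, hs]), ih, hs]
      · by_cases hx : x (g t) = x (g t + 1)
        · rw [changeCount_succ_of_eq (by rw [hg, hg, hs, hx]), hs, changeCount_succ_of_eq hx, ih]
        · rw [changeCount_succ_of_ne (by rwa [hg, hg, hs]), hs, changeCount_succ_of_ne hx, ih]
  have heq : (fun t => (changeCount y t, y t)) = (fun t => (changeCount x t, x t)) ∘ g := by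
    funext t
    simp [hcount, hg]
  rw [phaseTrace, heq, hsurj.range_comp, phaseTrace]

/-- `w` is a stuttering of some path from `s`. -/
def StutteredPath {S : Type} (δ : S → S → Prop) (s : S) (w : ℕ → S) : Prop :=
  ∃ p, TSPath δ s p ∧ Stutters p w

lemma stutteredPath_of_steps {S : Type} {δ : S → S → Prop} {s : S} {w : ℕ → S} (h0 : w 0 = s)
    (hstep : ∀ i, δ (w i) (w (i + 1)) ∨ w (i + 1) = w i)
    (hinf : ∀ N, ∃ i ≥ N, δ (w i) (w (i + 1))) : StutteredPath δ s w := by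
  classical
  set q : ℕ → Prop := fun i => δ (w i) (w (i + 1))
  have hinf' : {i | q i}.Infinite := by
    rw [← Nat.frequently_atTop_iff_infinite, Filter.frequently_atTop]
    exact hinf
  have hw : ∀ t, w t = w (Nat.nth q (Nat.count q t)) := by
    intro t
    have hle : t ≤ Nat.nth q (Nat.count q t) := Nat.le_nth_count hinf' t
    have hconst : ∀ s, t ≤ s → s ≤ Nat.nth q (Nat.count q t) → w s = w t := by
      intro s hs
      induction s, hs using Nat.le_induction with
      | base => intro _; rfl
      | succ s hs ih =>
        intro hlt
        rw [← ih (by omega)]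
        refine (hstep s).resolve_left fun hδ => ?_
        have h1 : Nat.count q s < Nat.count q t + 1 := by
          have := (Nat.count_le_iff_le_nth (p := q) hinf' (a := s) (b := Nat.count q t)).2 (by omega)
          omega
        have h2 : Nat.count q t ≤ Nat.count q s := Nat.count_monotone _ hs
        have h3 : Nat.nth q (Nat.count q s) = s := Nat.nth_count hδ
        rw [show Nat.count q s = Nat.count q t by omega] at h3
        omega
    exact (hconst _ hle le_rfl).symm
  refine ⟨fun k => w (Nat.nth q k), ⟨?_, fun k => ?_⟩, Nat.count q, Nat.count_monotone q,
    fun k => ⟨Nat.nth q k, Nat.count_nth_of_infinite hinf' k⟩, Nat.count_zero q, hw⟩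
  · have := hw 0
    rw [Nat.count_zero] at this
    exact this.symm.trans h0
  · have hk : q (Nat.nth q k) := Nat.nth_mem_of_infinite hinf' k
    have hs := hw (Nat.nth q k + 1)
    rw [Nat.count_succ, Nat.count_nth_of_infinite hinf', if_pos hk] at hs
    beta_reduce
    rw [← hs]
    exact hk

/-- A finite stuttered path can be continued by any successor of its last state. -/
lemma exists_stutteredPath_extending {S : Type} {δ : S → S → Prop}
    (hserial : ∀ s, ∃ s', δ s s') {w : ℕ → S} {t : ℕ} {x : S}
    (hstep : ∀ i < t, δ (w i) (w (i + 1)) ∨ w (i + 1) = w i) (hx : δ (w t) x) :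
    ∃ w', StutteredPath δ (w 0) w' ∧ (∀ i ≤ t, w' i = w i) ∧ w' (t + 1) = x := by
  choose f hf using hserial
  set w' : ℕ → S := fun i => if i ≤ t then w i else f^[i - (t + 1)] x with hw'
  have hpre : ∀ i ≤ t, w' i = w i := fun i hi => by simp [hw', hi]
  have hpost : ∀ d, w' (t + 1 + d) = f^[d] x := fun d => by
    simp [hw', show ¬ t + 1 + d ≤ t by omega]
  have hδ : ∀ i ≥ t, δ (w' i) (w' (i + 1)) := by
    intro i hi
    rcases hi.lt_or_eq with hlt | rfl
    · obtain ⟨d, rfl⟩ := Nat.exists_eq_add_of_le (show t + 1 ≤ i from hlt)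
      rw [hpost, add_assoc (t + 1), hpost, Function.iterate_succ_apply']
      exact hf _
    · rw [hpre _ le_rfl, show t + 1 = t + 1 + 0 from rfl, hpost]
      exact hx
  refine ⟨w', stutteredPath_of_steps (hpre 0 (by omega)) (fun i => ?_) (fun N => ?_), hpre, hpost 0⟩
  · rcases lt_or_ge i t with hi | hi
    · rw [hpre i hi.le, hpre (i + 1) hi]
      exact hstep i hi
    · exact Or.inl (hδ i hi)
  · exact ⟨max N t, le_max_left _ _, hδ _ (le_max_right _ _)⟩

/-- Against any scheduler, the proposals can follow prescribed paths. -/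
lemma exists_play_along_paths {S : Type} {n : ℕ} {s0 : S} {δ : S → S → Prop}
    (g : List (Fin n → S) → (Fin n → S) → Finset (Fin n))
    {p : Fin n → ℕ → S} (hp : ∀ j, TSPath δ s0 (p j)) :
    ∃ u prop, IsPlay s0 δ g u prop ∧
      ∀ j, FairFor g u prop j → Stutters (p j) (fun t => u t j) := by
  let next : (Fin n → ℕ) → Fin n → S := fun pos j => p j (pos j + 1)
  let adv : List (Fin n → S) → (Fin n → ℕ) → Fin n → ℕ := fun h pos j =>
    if j ∈ g h (next pos) then pos j + 1 else pos j
  let st : ℕ → List (Fin n → S) × (Fin n → ℕ) := fun i =>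
    Nat.rec ([fun _ => s0], fun _ => 0)
      (fun _ a => (a.1 ++ [fun j => p j (adv a.1 a.2 j)], adv a.1 a.2)) i
  let u : ℕ → Fin n → S := fun i j => p j ((st i).2 j)
  let prop : ℕ → Fin n → S := fun i => next (st i).2
  have hu0 : u 0 = fun _ => s0 := funext fun j => (hp j).1
  have hhist : ∀ i, (st i).1 = histn u i := by
    intro i
    induction i with
    | zero => simp [histn, hu0, st]
    | succ i ih =>
      rw [histn, List.range_succ, List.map_append, ← histn, ← ih]
      rfl
  have hpos : ∀ i j, (st (i + 1)).2 j =
      if j ∈ g (histn u i) (prop i) then (st i).2 j + 1 else (st i).2 j := by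
    intro i j
    rw [← hhist]
  refine ⟨u, prop, ⟨hu0, fun i => ⟨fun j => (hp j).2 _, fun j => ?_⟩⟩, fun j hfair => ?_⟩
  · change p j ((st (i + 1)).2 j) = _
    rw [hpos]
    split_ifs <;> rfl
  · have hcount : ∀ t, (st t).2 j = Nat.count (fun i => j ∈ g (histn u i) (prop i)) t := by
      intro t
      induction t with
      | zero => simp [st]
      | succ t ih =>
        rw [hpos, Nat.count_succ, ← ih]
        split_ifs <;> rfl
    have hinf : {i | j ∈ g (histn u i) (prop i)}.Infinite := by
      rw [← Nat.frequently_atTop_iff_infinite, Filter.frequently_atTop]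
      exact hfair
    exact ⟨_, Nat.count_monotone _, fun k => ⟨_, Nat.count_nth_of_infinite hinf k⟩,
      Nat.count_zero _, fun t => congrArg (p j) (hcount t)⟩

open Classical in
/-- The scheduler that lets a copy progress if its colour is unchanged, or if the colours of all
copies change. -/
noncomputable def phaseScheduler {S C : Type} {n : ℕ} (c : S → C) (h : List (Fin n → S))
    (v : Fin n → S) : Finset (Fin n) :=
  Finset.univ.filter fun j =>
    c (v j) = c (h.getLastD v j) ∨ ∀ k, c (v k) ≠ c (h.getLastD v k)

lemma mem_phaseScheduler_histn {S C : Type} {n : ℕ} {c : S → C} {u : ℕ → Fin n → S} {i : ℕ}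
    {v : Fin n → S} {j : Fin n} : j ∈ phaseScheduler c (histn u i) v ↔
      c (v j) = c (u i j) ∨ ∀ k, c (v k) ≠ c (u i k) := by
  have hlast : (histn u i).getLastD v = u i := by
    rw [histn, List.range_succ, List.map_append]
    simp
  simp [phaseScheduler, -List.getLastD_eq_getLast?, hlast]

lemma IsPlay.step {S : Type} {n : ℕ} {s0 : S} {δ : S → S → Prop}
    {g : List (Fin n → S) → (Fin n → S) → Finset (Fin n)} {u prop : ℕ → Fin n → S}
    (h : IsPlay s0 δ g u prop) (i : ℕ) (j : Fin n) :
    δ (u i j) (u (i + 1) j) ∨ u (i + 1) j = u i j := by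
  rw [(h.2 i).2 j]
  split_ifs
  · exact Or.inl ((h.2 i).1 j)
  · exact Or.inr rfl

lemma IsPlay.stutteredPath {S : Type} {n : ℕ} {s0 : S} {δ : S → S → Prop}
    {g : List (Fin n → S) → (Fin n → S) → Finset (Fin n)} {u prop : ℕ → Fin n → S}
    (h : IsPlay s0 δ g u prop) {j : Fin n} (hfair : FairFor g u prop j) :
    StutteredPath δ s0 (fun t => u t j) := by
  refine stutteredPath_of_steps (congrFun h.1 j) (fun i => h.step i j) fun N => ?_
  obtain ⟨i, hi, hj⟩ := hfair N
  refine ⟨i, hi, ?_⟩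
  rw [(h.2 i).2 j, if_pos hj]
  exact (h.2 i).1 j

/-- If all stuttered paths have the same phase trace, the phase scheduler keeps the colours of
all copies equal. -/
lemma colours_eq_of_isPlay_phaseScheduler {S C : Type} {n : ℕ} {s0 : S} {δ : S → S → Prop}
    (hserial : ∀ s, ∃ s', δ s s') {c : S → C}
    (htrace : ∀ w w', StutteredPath δ s0 w → StutteredPath δ s0 w' →
      phaseTrace (c ∘ w) = phaseTrace (c ∘ w'))
    {u prop : ℕ → Fin n → S} (h : IsPlay s0 δ (phaseScheduler c) u prop) (t : ℕ) (j k : Fin n) :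
    c (u t j) = c (u t k) := by
  induction t using Nat.strong_induction_on with
  | _ t ih =>
    rcases t with - | t
    · rw [h.1]
    by_cases hall : ∀ k, c (prop t k) ≠ c (u t k)
    · have hnext : ∀ l, u (t + 1) l = prop t l := fun l => by
        rw [(h.2 t).2 l, if_pos (mem_phaseScheduler_histn.2 (Or.inr hall))]
      have hext := fun l => exists_stutteredPath_extending hserial (w := fun s => u s l)
        (fun i _ => h.step i l) ((h.2 t).1 l)
      simp only [h.1] at hext
      obtain ⟨w, hw, hwpre, hwt⟩ := hext j
      obtain ⟨w', hw', hwpre', hwt'⟩ := hext k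
      rw [hnext, hnext, ← hwt, ← hwt']
      refine eq_of_phaseTrace_eq (htrace w w' hw hw') ?_
      rw [changeCount_succ_of_ne, changeCount_succ_of_ne, changeCount_congr]
      · intro s hs
        simp only [Function.comp, hwpre s hs, hwpre' s hs]
        exact ih s (by omega)
      · simp only [Function.comp, hwt', hwpre' t le_rfl]
        exact (hall k).symm
      · simp only [Function.comp, hwt, hwpre t le_rfl]
        exact (hall j).symm
    · have hsame : ∀ l, c (u (t + 1) l) = c (u t l) := fun l => by
        rw [(h.2 t).2 l]
        split_ifs with hl
        · exact (mem_phaseScheduler_histn.1 hl).resolve_right hall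
        · rfl
      rw [hsame, hsame]
      exact ih t (by omega)

lemma fairFor_phaseScheduler {S C : Type} {s0 : S} {δ : S → S → Prop}
    (hserial : ∀ s, ∃ s', δ s s') {c : S → C}
    (htrace : ∀ w w', StutteredPath δ s0 w → StutteredPath δ s0 w' →
      phaseTrace (c ∘ w) = phaseTrace (c ∘ w'))
    {u prop : ℕ → Fin 2 → S} (h : IsPlay s0 δ (phaseScheduler c) u prop) (j : Fin 2) :
    FairFor (phaseScheduler c) u prop j := by
  by_contra hunfair
  simp only [FairFor, not_forall, not_exists, not_and] at hunfair
  obtain ⟨N, hN⟩ := hunfair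
  have hcol := colours_eq_of_isPlay_phaseScheduler hserial htrace h
  obtain ⟨k, hk⟩ : ∃ k, ∀ l : Fin 2, l = j ∨ l = k := by
    clear hN
    revert j
    decide
  have hstall : ∀ i ≥ N, c (prop i j) ≠ c (u i j) ∧ c (prop i k) = c (u i k) := by
    intro i hi
    have hj := hN i hi
    rw [mem_phaseScheduler_histn] at hj
    push Not at hj
    obtain ⟨hj, l, hl⟩ := hj
    rcases hk l with rfl | rfl
    · exact absurd hl hj
    · exact ⟨hj, hl⟩
  have hkmem : ∀ i ≥ N, k ∈ phaseScheduler c (histn u i) (prop i) := fun i hi =>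
    mem_phaseScheduler_histn.2 (Or.inl (hstall i hi).2)
  have hkpath := h.stutteredPath (j := k) fun M =>
    ⟨max M N, le_max_left _ _, hkmem _ (le_max_right _ _)⟩
  obtain ⟨w, hw, hwpre, hwN⟩ := exists_stutteredPath_extending hserial (w := fun s => u s j)
    (fun i _ => h.step i j) ((h.2 N).1 j)
  simp only [h.1] at hw
  have hmem : (changeCount (c ∘ w) (N + 1), (c ∘ w) (N + 1)) ∈
      phaseTrace (c ∘ fun t => u t k) := htrace _ _ hw hkpath ▸ ⟨N + 1, rfl⟩
  obtain ⟨a, ha⟩ := hmem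
  simp only [Prod.mk.injEq] at ha
  have hle : changeCount (c ∘ fun t => u t k) a ≤ changeCount (c ∘ fun t => u t k) N := by
    refine changeCount_le_of_eventually_const (fun i hi => ?_) a
    simp only [Function.comp]
    rw [(h.2 i).2 k, if_pos (hkmem i hi), (hstall i hi).2]
  have hne : changeCount (c ∘ w) (N + 1) = changeCount (c ∘ w) N + 1 := by
    refine changeCount_succ_of_ne ?_
    simp only [Function.comp, hwN, hwpre N le_rfl]
    exact (hstall N le_rfl).1.symm
  have heq : changeCount (c ∘ w) N = changeCount (c ∘ fun t => u t k) N := by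
    refine changeCount_congr fun s hs => ?_
    simp only [Function.comp, hwpre s hs]
    exact hcol s j k
  omega

/-- For admissible properties, the existence of a fair 2-scheduler enforcing
`Φ` is equivalent to the existence, for any two paths, of stutterings
satisfying `Φ`. -/
theorem admissible_scheduler_iff_stutterings {S AP : Type} [Fintype S]
    (s0 : S) (δ : S → S → Prop) (hserial : ∀ s, ∃ s', δ s s')
    (Lab : S → Set AP) (P : Set AP)
    (Φstate : S → S → Prop) (Φ1 Φ2 : (ℕ → S) → Prop)
    (hΦ1 : ∀ p p', Stutters p p' → (Φ1 p ↔ Φ1 p'))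
    (hΦ2 : ∀ p p', Stutters p p' → (Φ2 p ↔ Φ2 p')) :
    (∃ g : List (Fin 2 → S) → (Fin 2 → S) → Finset (Fin 2),
      ∀ u prop : ℕ → Fin 2 → S, IsPlay s0 δ g u prop →
        (∀ j, FairFor g u prop j) ∧
        AdmissibleProp Lab P Φstate Φ1 Φ2 (fun t => u t 0) (fun t => u t 1)) ↔
    (∀ p1 p2 : ℕ → S, TSPath δ s0 p1 → TSPath δ s0 p2 →
      ∃ p1' p2' : ℕ → S, Stutters p1 p1' ∧ Stutters p2 p2' ∧
        AdmissibleProp Lab P Φstate Φ1 Φ2 p1' p2') := by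
  constructor
  · rintro ⟨g, hg⟩ p1 p2 hp1 hp2
    have hp : ∀ j, TSPath δ s0 ((![p1, p2] : Fin 2 → ℕ → S) j) := by
      intro j
      fin_cases j
      · exact hp1
      · exact hp2
    obtain ⟨u, prop, hplay, hst⟩ := exists_play_along_paths g hp
    obtain ⟨hfair, hadm⟩ := hg u prop hplay
    exact ⟨_, _, hst 0 (hfair 0), hst 1 (hfair 1), hadm⟩
  · intro h
    have htrace : ∀ w w', StutteredPath δ s0 w → StutteredPath δ s0 w' →
        phaseTrace ((fun s => Lab s ∩ P) ∘ w) = phaseTrace ((fun s => Lab s ∩ P) ∘ w') := by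
      rintro w w' ⟨p, hp, hpw⟩ ⟨q, hq, hqw⟩
      obtain ⟨p', q', hp', hq', -, -, -, hlab⟩ := h p q hp hq
      rw [(hpw.comp _).phaseTrace_eq, (hqw.comp _).phaseTrace_eq,
        ← (hp'.comp fun s => Lab s ∩ P).phaseTrace_eq,
        ← (hq'.comp fun s => Lab s ∩ P).phaseTrace_eq]
      exact congrArg phaseTrace (funext hlab)
    refine ⟨phaseScheduler fun s => Lab s ∩ P, fun u prop hplay => ?_⟩
    have hfair := fairFor_phaseScheduler hserial htrace hplay
    obtain ⟨p, hp, hpu⟩ := hplay.stutteredPath (hfair 0)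
    obtain ⟨q, hq, hqu⟩ := hplay.stutteredPath (hfair 1)
    obtain ⟨p', q', hp', hq', hstate, h1, h2, -⟩ := h p q hp hq
    refine ⟨hfair, ?_, (hΦ1 _ _ hpu).1 ((hΦ1 _ _ hp').2 h1),
      (hΦ2 _ _ hqu).1 ((hΦ2 _ _ hq').2 h2),
      fun t => colours_eq_of_isPlay_phaseScheduler hserial htrace hplay t 0 1⟩
    obtain ⟨f, -, -, hf0, hf⟩ := hp'
    obtain ⟨g, -, -, hg0, hg⟩ := hq'
    rw [hf, hg, hf0, hg0, hp.1, hq.1] at hstate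
    simpa only [hplay.1] using hstate
end

section
/- Let G be a CGS, n ≥ 0, N a nondeterministic parity automaton over alphabet S^{n+1}, and 𝔄 the nondeterministic parity automaton over alphabet S^n constructed as the existential product of G and N as described. Then for all p_1, …, p_n ∈ S^ω: ⊗(p_1, …, p_n) ∈ L(𝔄) if and only if there exists a path p of G from s° with ⊗(p_1, …, p_n, p) ∈ L(N), where s° = p_n(0) if n ≥ 1 and s° = s0 if n = 0. -/
/-- `cs` satisfies the parity condition: the minimal color occurring
infinitely often in `cs` is even. -/
def ParityAccept (cs : ℕ → ℕ) : Prop :=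
  ∃ d, Even d ∧ (∀ N, ∃ k ≥ N, cs k = d) ∧ ∀ d' < d, ∃ N, ∀ k ≥ N, cs k ≠ d'

/-- A nondeterministic parity automaton over alphabet `Alph` with states `Q`. -/
structure NPA (Alph Q : Type) where
  q0 : Q
  ρ : Q → Alph → Set Q
  c : Q → ℕ

/-- `r` is a run of the NPA `N` on the word `w`. -/
def NPA.IsRun {Alph Q : Type} (N : NPA Alph Q) (w : ℕ → Alph) (r : ℕ → Q) : Prop :=
  r 0 = N.q0 ∧ ∀ t, r (t + 1) ∈ N.ρ (r t) (w t)

/-- `w ∈ L(N)` for the NPA `N`. -/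
def NPA.Accepts {Alph Q : Type} (N : NPA Alph Q) (w : ℕ → Alph) : Prop :=
  ∃ r : ℕ → Q, N.IsRun w r ∧ ParityAccept (fun t => N.c (r t))

/-- `s° = s_n` (the last component of `v`) if `n ≥ 1`, and `s° = s0` if `n = 0`. -/
def sCirc {S : Type} (s0 : S) {n : ℕ} (v : Fin n → S) : S :=
  if h : 0 < n then v ⟨n - 1, Nat.sub_lt h Nat.one_pos⟩ else s0

/-- The existential product of the CGS `G` and the NPA `N` over alphabet
`S^{n+1}`: a nondeterministic parity automaton over alphabet `Sⁿ` that guesses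
a path of `G` and tracks `N` on the combined word. -/
def constructNPA {S Agent M AP Q : Type} (G : CGS S Agent M AP) {n : ℕ}
    (N : NPA (Fin (n + 1) → S) Q) : NPA (Fin n → S) ((S × Q) ⊕ Unit) where
  q0 := Sum.inr ()
  ρ := fun q v =>
    match q with
    | Sum.inr _ =>
        {x | ∃ s' q', x = Sum.inl (s', q') ∧
          q' ∈ N.ρ N.q0 (Fin.snoc v (sCirc G.s0 v)) ∧
          ∃ σ : Agent → M, G.δ (sCirc G.s0 v) σ = s'}
    | Sum.inl (s, q) =>
        {x | ∃ s' q', x = Sum.inl (s', q') ∧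
          q' ∈ N.ρ q (Fin.snoc v s) ∧
          ∃ σ : Agent → M, G.δ s σ = s'}
  c := fun q =>
    match q with
    | Sum.inl (_, q) => N.c q
    | Sum.inr _ => 0

/-- The parity condition does not depend on the first color. -/
theorem ParityAccept.of_succ_eq {a b : ℕ → ℕ} (h : ∀ t, a (t + 1) = b (t + 1))
    (ha : ParityAccept a) : ParityAccept b := by
  have hk : ∀ k ≥ 1, a k = b k := by
    intro k hk
    obtain ⟨t, rfl⟩ := Nat.exists_eq_add_of_le' hk
    exact h t
  obtain ⟨d, hd, hinf, hfin⟩ := ha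
  refine ⟨d, hd, fun K => ?_, fun d' hd' => ?_⟩
  · obtain ⟨k, hkK, hkd⟩ := hinf (K + 1)
    exact ⟨k, by omega, by rw [← hk k (by omega), hkd]⟩
  · obtain ⟨K, hK⟩ := hfin d' hd'
    refine ⟨K + 1, fun k hkK => ?_⟩
    rw [← hk k (by omega)]
    exact hK k (by omega)

/-- The existential product accepts `⊗(p_1, …, p_n)` iff there is a path `p`
of `G` from `s°` with `⊗(p_1, …, p_n, p) ∈ L(N)`. -/
theorem constructNPA_accepts_iff {S Agent M AP Q : Type}
    [Fintype S] [Fintype Agent] [Nonempty Agent]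
    [Fintype M] [Nonempty M] [Fintype AP] [Fintype Q]
    (G : CGS S Agent M AP) (n : ℕ)
    (N : NPA (Fin (n + 1) → S) Q)
    (ps : Fin n → ℕ → S) :
    (constructNPA G N).Accepts (fun t j => ps j t) ↔
    ∃ p : ℕ → S, IsPath G.δ (sCirc G.s0 (fun j => ps j 0)) p ∧
      N.Accepts (fun t => Fin.snoc (fun j => ps j t) (p t)) := by
  constructor
  · rintro ⟨r, ⟨hr0, hr⟩, hacc⟩
    have hinl : ∀ t, ∃ x : S × Q, r (t + 1) = Sum.inl x := by
      intro t
      have ht := hr t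
      generalize r t = x at ht
      rcases x with ⟨s, q⟩ | _ <;> obtain ⟨s', q', h, -⟩ := ht <;> exact ⟨_, h⟩
    choose f hf using hinl
    refine ⟨fun t => Nat.casesOn t (sCirc G.s0 fun j => ps j 0) fun t => (f t).1,
      ⟨rfl, ?_⟩, fun t => Nat.casesOn t N.q0 fun t => (f t).2, ⟨rfl, ?_⟩,
      hacc.of_succ_eq fun t => ?_⟩
    · rintro (_ | t)
      · have h := hr 0
        rw [hr0, hf] at h
        obtain ⟨s', q', h, -, hσ⟩ := h
        simpa [Sum.inl.inj h] using hσ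
      · have h := hr (t + 1)
        rw [hf, hf] at h
        obtain ⟨s', q', h, -, hσ⟩ := h
        simpa [Sum.inl.inj h] using hσ
    · rintro (_ | t)
      · have h := hr 0
        rw [hr0, hf] at h
        obtain ⟨s', q', h, hq, -⟩ := h
        simpa [Sum.inl.inj h] using hq
      · have h := hr (t + 1)
        rw [hf, hf] at h
        obtain ⟨s', q', h, hq, -⟩ := h
        simpa [Sum.inl.inj h] using hq
    · simp only [hf]
      rfl
  · rintro ⟨p, ⟨hp0, hp⟩, r, ⟨hr0, hr⟩, hacc⟩
    refine ⟨fun t => Nat.casesOn t (Sum.inr ()) fun t => Sum.inl (p (t + 1), r (t + 1)),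
      ⟨rfl, ?_⟩, hacc.of_succ_eq fun _ => rfl⟩
    rintro (_ | t)
    · refine ⟨_, _, rfl, ?_, ?_⟩
      · rw [← hp0, ← hr0]
        exact hr 0
      · rw [← hp0]
        exact hp 0
    · exact ⟨_, _, rfl, hr (t + 1), hp (t + 1)⟩
end

section
/- Let m ≥ 1 and let α, β : {0, …, m−1} → {0, 1} be two m-bit vectors, interpreted in big-endian encoding with value c(γ) = Σ_{i=0}^{m−1} γ(i) · 2^{m−1−i} (so index m−1 is the least significant bit). Then c(β) ≡ c(α) + 1 (mod 2^m) if and only if for every i < m: α(i) = β(i) ⟺ there exists j with i < j < m and α(j) = 0. -/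
/-- The value of an `m`-bit vector `γ` in big-endian encoding: the bit at
index `m - 1` is least significant. -/
def counterValue (m : ℕ) (γ : Fin m → ℕ) : ℕ :=
  ∑ i : Fin m, γ i * 2 ^ (m - 1 - (i : ℕ))

theorem counterValue_succ (m : ℕ) (γ : Fin (m + 1) → ℕ) :
    counterValue (m + 1) γ = γ 0 * 2 ^ m + counterValue m (fun i => γ i.succ) := by
  unfold counterValue
  rw [Fin.sum_univ_succ]
  congr 1
  refine Finset.sum_congr rfl fun i _ => ?_
  congr 2
  simp only [Fin.val_succ]
  omega

theorem counterValue_lt (m : ℕ) (γ : Fin m → ℕ) (hγ : ∀ i, γ i ≤ 1) :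
    counterValue m γ < 2 ^ m := by
  induction m with
  | zero => simp [counterValue]
  | succ m ih =>
    have h := ih (fun i => γ i.succ) fun i => hγ i.succ
    have h0 : γ 0 * 2 ^ m ≤ 1 * 2 ^ m := Nat.mul_le_mul_right _ (hγ 0)
    rw [counterValue_succ, pow_succ]
    omega

/-- A counter holds its maximal value exactly when none of its bits is `0`. -/
theorem counterValue_add_one_eq_iff (m : ℕ) (γ : Fin m → ℕ) (hγ : ∀ i, γ i ≤ 1) :
    counterValue m γ + 1 = 2 ^ m ↔ ∀ i, γ i ≠ 0 := by
  induction m with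
  | zero => simp [counterValue]
  | succ m ih =>
    have h := ih (fun i => γ i.succ) fun i => hγ i.succ
    have hlt := counterValue_lt m (fun i => γ i.succ) fun i => hγ i.succ
    rw [Fin.forall_fin_succ, ← h, counterValue_succ, pow_succ]
    rcases Nat.le_one_iff_eq_zero_or_eq_one.mp (hγ 0) with h0 | h0 <;> rw [h0] <;> omega

theorem modEq_add_one_iff_of_lt {x y n : ℕ} (hx : x < n) (hy : y < n) :
    x ≡ y + 1 [MOD n] ↔ x = y + 1 ∨ (x = 0 ∧ y + 1 = n) := by
  unfold Nat.ModEq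
  rw [Nat.mod_eq_of_lt hx]
  rcases Nat.lt_or_eq_of_le (Nat.succ_le_of_lt hy) with h | h
  · rw [Nat.mod_eq_of_lt h]
    omega
  · rw [← Nat.succ_eq_add_one, h, Nat.mod_self]
    omega

/-- Incrementing a counter increments its tail and keeps the leading bit exactly when
the tail does not overflow. -/
theorem counterValue_succ_modEq_iff (m : ℕ) (α β : Fin (m + 1) → ℕ)
    (hα : ∀ i, α i ≤ 1) (hβ : ∀ i, β i ≤ 1) :
    counterValue (m + 1) β ≡ counterValue (m + 1) α + 1 [MOD 2 ^ (m + 1)] ↔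
    (α 0 = β 0 ↔ ∃ j : Fin m, α j.succ = 0) ∧
      counterValue m (fun i => β i.succ) ≡ counterValue m (fun i => α i.succ) + 1 [MOD 2 ^ m] := by
  have ha := counterValue_lt m (fun i => α i.succ) fun i => hα i.succ
  have hb := counterValue_lt m (fun i => β i.succ) fun i => hβ i.succ
  have hmax : (∃ j : Fin m, α j.succ = 0) ↔
      ¬ counterValue m (fun i => α i.succ) + 1 = 2 ^ m := by
    rw [counterValue_add_one_eq_iff m _ fun i => hα i.succ]
    push Not
    rfl
  rw [modEq_add_one_iff_of_lt (counterValue_lt _ β hβ) (counterValue_lt _ α hα),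
    modEq_add_one_iff_of_lt hb ha, hmax, counterValue_succ, counterValue_succ, pow_succ]
  rcases Nat.le_one_iff_eq_zero_or_eq_one.mp (hα 0) with h0 | h0 <;>
    rcases Nat.le_one_iff_eq_zero_or_eq_one.mp (hβ 0) with h1 | h1 <;>
    rw [h0, h1] <;> omega

/-- `β` encodes the increment of `α` modulo `2^m` iff for every index `i`, the
bits `α(i)` and `β(i)` agree exactly when some strictly less significant bit of
`α` is `0`. -/
theorem counter_increment_iff (m : ℕ) (hm : 1 ≤ m)
    (α β : Fin m → ℕ) (hα : ∀ i, α i ≤ 1) (hβ : ∀ i, β i ≤ 1) :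
    counterValue m β ≡ counterValue m α + 1 [MOD 2 ^ m] ↔
    ∀ i : Fin m, (α i = β i ↔ ∃ j : Fin m, (i : ℕ) < (j : ℕ) ∧ α j = 0) := by
  clear hm
  induction m with
  | zero => simp [counterValue, Nat.ModEq, Nat.mod_one]
  | succ m ih =>
    rw [counterValue_succ_modEq_iff m α β hα hβ,
      ih _ _ (fun i => hα i.succ) fun i => hβ i.succ, Fin.forall_fin_succ]
    simp [Fin.exists_fin_succ]
end

section
/- Define C : ℕ × ℕ → ℕ by C(0, n) = n and C(k+1, n) = 2^{2^{C(k, n)}} · 2^{C(k, n)} · C(k, n), and define Tower₂ : ℕ × ℕ → ℕ by Tower₂(0, n) = n and Tower₂(k+1, n) = 2^{Tower₂(k, n)}. Then for every k ≥ 1 and every n ≥ 1, C(k, n) ≥ Tower₂(2k, n). -/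
/-- The yardstick length `C(k, n)` enforced by the counter construction with
`k` complex quantifiers and parameter `n`. -/
def Cfun : ℕ → ℕ → ℕ
  | 0, n => n
  | k + 1, n => 2 ^ (2 ^ Cfun k n) * 2 ^ Cfun k n * Cfun k n

/-- A tower of `k` exponentials with base `2` on top of `n`. -/
def Tower2 : ℕ → ℕ → ℕ
  | 0, n => n
  | k + 1, n => 2 ^ Tower2 k n

theorem Cfun_pos (k : ℕ) {n : ℕ} (hn : 1 ≤ n) : 0 < Cfun k n := by
  induction k with
  | zero => exact hn
  | succ k ih =>
    rw [Cfun]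
    positivity

theorem Tower2_two_mul_le_Cfun (k : ℕ) {n : ℕ} (hn : 1 ≤ n) :
    Tower2 (2 * k) n ≤ Cfun k n := by
  induction k with
  | zero => exact le_rfl
  | succ k ih =>
    calc Tower2 (2 * (k + 1)) n = 2 ^ 2 ^ Tower2 (2 * k) n := rfl
      _ ≤ 2 ^ 2 ^ Cfun k n :=
        Nat.pow_le_pow_right two_pos (Nat.pow_le_pow_right two_pos ih)
      _ ≤ 2 ^ 2 ^ Cfun k n * 2 ^ Cfun k n :=
        Nat.le_mul_of_pos_right _ (Nat.two_pow_pos _)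
      _ ≤ 2 ^ 2 ^ Cfun k n * 2 ^ Cfun k n * Cfun k n :=
        Nat.le_mul_of_pos_right _ (Cfun_pos k hn)

/-- For every `k ≥ 1` and `n ≥ 1`, `C(k, n) ≥ Tower₂(2k, n)`. -/
theorem Cfun_ge_Tower2 (k n : ℕ) (hk : 1 ≤ k) (hn : 1 ≤ n) :
    Tower2 (2 * k) n ≤ Cfun k n := by
  exact Tower2_two_mul_le_Cfun k hn
end
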